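/- Let E be a generalized Banach space and S a nonempty closed convex subset of E. Let Q be a multivalued mapping on S with a closed graph whose values Q(x) are nonempty closed convex subsets of S. If Q(S) is relatively compact, then Q has at least one fixed point in S. -/

import Mathlib

open Filter Topology Set Bornology

/-- A multivalued map `Q` on `S` has a closed graph: whenever `xₘ ∈ S`, `xₘ → a ∈ S`,
`yₘ ∈ Q xₘ` and `yₘ → b`, then `b ∈ Q a`. -/
def HasClosedGraphMV {E : Type*} [TopologicalSpace E] (S : Set E) (Q : E → Set E) : Prop :=
  ∀ (x y : ℕ → E) (a b : E), (∀ m, x m ∈ S) → a ∈ S →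
    Tendsto x atTop (nhds a) → (∀ m, y m ∈ Q (x m)) → Tendsto y atTop (nhds b) → b ∈ Q a

section Scarf

variable {I V α : Type*} [LinearOrder α]

/-- A finite set `σ` is dominant for a family of rankings `r` if no element is ranked strictly
above the minimum of `σ` by every ranking. -/
def IsDominant (r : I → V → α) (σ : Finset V) : Prop :=
  ∀ y, ∃ i, ∀ x ∈ σ, r i y ≤ r i x

theorem IsDominant.mono {r : I → V → α} {σ τ : Finset V} (h : IsDominant r σ) (hτ : τ ⊆ σ) :
    IsDominant r τ := fun y => (h y).imp fun _ hi x hx => hi x (hτ hx)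

variable [Fintype I] [Fintype V] [DecidableEq V]

open Classical in
/-- A dominant set with one element less than there are rankings, containing an element which is
not extremal, extends in exactly two ways to a dominant set with one more element. -/
theorem IsDominant.card_extensions_eq_two {r : I → V → α} (hr : ∀ i, Function.Injective (r i))
    {e : I → V} (he_top : ∀ i j v, i ≠ j → v ∉ range e → r i v < r i (e j))
    {τ : Finset V} (hτ : IsDominant r τ) (hcard : τ.card + 1 = Fintype.card I)
    {v : V} (hv : v ∈ τ) (hve : v ∉ range e) :
    (Finset.univ.filter fun σ : Finset V =>
      (σ.card = Fintype.card I ∧ IsDominant r σ) ∧ τ ⊆ σ).card = 2 := by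
  have hmin : ∀ i, ∃ x ∈ τ, ∀ x' ∈ τ, r i x ≤ r i x' :=
    fun i => Finset.exists_min_image τ (r i) ⟨v, hv⟩
  choose a haτ ha using hmin
  have hnot : ∀ y, ¬ ∀ i, r i (a i) < r i y := fun y hy => by
    obtain ⟨i, hi⟩ := hτ y
    exact absurd (hi _ (haτ i)) (not_le.2 (hy i))
  obtain ⟨j, -, k, -, hjk, hajk⟩ := Finset.exists_ne_map_eq_of_card_lt_of_maps_to
    (s := (Finset.univ : Finset I)) (t := τ) (f := a)
    (by rw [Finset.card_univ]; omega) (fun i _ => haτ i)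
  have hM : ∀ l, ∃ y, (∀ i, i ≠ l → r i (a i) < r i y) ∧
      ∀ z, (∀ i, i ≠ l → r i (a i) < r i z) → r l z ≤ r l y := fun l => by
    obtain ⟨y, hy, hmax⟩ := Finset.exists_max_image
      (Finset.univ.filter fun y => ∀ i, i ≠ l → r i (a i) < r i y) (r l)
      ⟨e l, by
        simp only [Finset.mem_filter, Finset.mem_univ, true_and]
        exact fun i hi => (ha i v hv).trans_lt (he_top i l v hi hve)⟩
    simp only [Finset.mem_filter, Finset.mem_univ, true_and] at hy hmax
    exact ⟨y, hy, hmax⟩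
  choose y hy hymax using hM
  have hyτ : ∀ l l', l' ≠ l → a l' = a l → y l ∉ τ := fun l l' hne hal hmem => by
    obtain ⟨i, hi⟩ := hτ (y l)
    have hyi : y l = a i := hr i (le_antisymm (hi _ (haτ i)) (ha i _ hmem))
    by_cases hil : i = l
    · have := hy l l' hne
      rw [hyi, hil, hal] at this
      exact lt_irrefl _ this
    · have := hy l i hil
      rw [hyi] at this
      exact lt_irrefl _ this
  have hdom : ∀ l, IsDominant r (insert (y l) τ) := fun l z => by
    by_contra! hcon
    have hz : ∀ i, i ≠ l → r i (a i) < r i z := fun i hi => by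
      obtain ⟨x, hx, hxz⟩ := hcon i
      rcases Finset.mem_insert.1 hx with rfl | hx
      · exact (hy l i hi).trans hxz
      · exact (ha i x hx).trans_lt hxz
    obtain ⟨x, hx, hxz⟩ := hcon l
    have hzl := hymax l z hz
    rcases Finset.mem_insert.1 hx with rfl | hxτ
    · exact absurd hxz (not_lt.2 hzl)
    · refine hnot (y l) fun i => ?_
      by_cases hil : i = l
      · subst hil
        exact ((ha i x hxτ).trans_lt hxz).trans_le hzl
      · exact hy l i hil
  have hyj := hyτ j k hjk.symm hajk.symm
  have hyk := hyτ k j hjk hajk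
  have hne : y j ≠ y k := fun h => hnot (y j) fun i => by
    by_cases hij : i = j
    · rw [h]; exact hy k i (hij ▸ hjk)
    · exact hy j i hij
  refine Finset.card_eq_two.2 ⟨insert (y j) τ, insert (y k) τ, fun h => ?_, ?_⟩
  · have : y j ∈ insert (y k) τ := h ▸ Finset.mem_insert_self _ _
    rcases Finset.mem_insert.1 this with h | h
    exacts [hne h, hyj h]
  ext σ
  simp only [Finset.mem_filter, Finset.mem_univ, true_and, Finset.mem_insert,
    Finset.mem_singleton]
  constructor
  · rintro ⟨⟨hσ, hσd⟩, hτσ⟩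
    obtain ⟨w, hw, rfl⟩ := Finset.exists_eq_insert_iff.2 ⟨hτσ, hcard.trans hσ.symm⟩
    choose g hg using hσd
    have hinj : Set.InjOn g (insert w τ : Finset V) := fun x hx x' hx' h =>
      hr (g x) (le_antisymm (hg x x' hx') (h ▸ hg x' x hx))
    have himg : (insert w τ).image g = Finset.univ := by
      rw [← Finset.card_eq_iff_eq_univ, Finset.card_image_of_injOn hinj, hσ]
    have hpre : ∀ i, i ≠ g w → a i ∈ τ ∧ g (a i) = i := fun i hi => by
      obtain ⟨x, hx, hxi⟩ := Finset.mem_image.1 (himg ▸ Finset.mem_univ i)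
      rcases Finset.mem_insert.1 hx with rfl | hx'
      · exact absurd hxi.symm hi
      · have : x = a i := hr i (le_antisymm
          (hxi ▸ hg x _ (Finset.mem_insert_of_mem (haτ _))) (ha i x hx'))
        exact ⟨haτ i, this ▸ hxi⟩
    have hwM : ∀ i, i ≠ g w → r i (a i) < r i w := fun i hi => by
      obtain ⟨h1, h2⟩ := hpre i hi
      refine lt_of_le_of_ne ?_ fun h => hw (hr i h ▸ h1)
      have := hg (a i) w (Finset.mem_insert_self _ _)
      rwa [h2] at this
    have hwy : w = y (g w) := by
      refine hr (g w) (le_antisymm (hymax _ _ hwM) ?_)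
      by_contra! hlt
      have h3 := hg (y (g w))
      by_cases hgl : g (y (g w)) = g w
      · have := h3 w (Finset.mem_insert_self _ _)
        rw [hgl] at this
        exact absurd hlt (not_lt.2 this)
      · exact absurd (hy _ _ hgl) (not_lt.2 (h3 _ (Finset.mem_insert_of_mem (haτ _))))
    by_cases hj : j = g w
    · left; rw [hj, ← hwy]
    by_cases hk : k = g w
    · right; rw [hk, ← hwy]
    · exact absurd ((hpre j hj).2.symm.trans (hajk ▸ (hpre k hk).2)) hjk
  · rintro (rfl | rfl)
    · exact ⟨⟨by rw [Finset.card_insert_of_notMem hyj, hcard], hdom j⟩, Finset.subset_insert _ _⟩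
    · exact ⟨⟨by rw [Finset.card_insert_of_notMem hyk, hcard], hdom k⟩, Finset.subset_insert _ _⟩

open Classical in
/-- The boundary set of all extremal elements but one extends in exactly one way to a dominant set
with as many elements as there are rankings. -/
theorem card_extensions_boundary_eq_one {r : I → V → α} (hr : ∀ i, Function.Injective (r i))
    {e : I → V} (he : Function.Injective e) (he_min : ∀ i v, r i (e i) ≤ r i v)
    (he_top : ∀ i j v, i ≠ j → v ∉ range e → r i v < r i (e j))
    (hV : ∃ v, v ∉ range e) (k : I) :
    IsDominant r ((Finset.univ.erase k).image e) ∧ (Finset.univ.filter fun σ : Finset V =>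
      (σ.card = Fintype.card I ∧ IsDominant r σ) ∧ (Finset.univ.erase k).image e ⊆ σ).card = 1 := by
  set τ := (Finset.univ.erase k).image e with hτdef
  have hcard : τ.card + 1 = Fintype.card I := by
    rw [hτdef, Finset.card_image_of_injective _ he, Finset.card_erase_add_one (Finset.mem_univ k),
      Finset.card_univ]
  have hmem : ∀ i, i ≠ k → e i ∈ τ := fun i hi =>
    Finset.mem_image_of_mem e (Finset.mem_erase.2 ⟨hi, Finset.mem_univ i⟩)
  obtain ⟨v, hv⟩ := hV
  obtain ⟨y, hy, hymax⟩ := Finset.exists_max_image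
    (Finset.univ.filter fun y => y ∉ range e) (r k) ⟨v, by simpa using hv⟩
  simp only [Finset.mem_filter, Finset.mem_univ, true_and] at hy hymax
  have hyτ : y ∉ τ := fun h => by
    obtain ⟨i, -, hi⟩ := Finset.mem_image.1 h
    exact hy ⟨i, hi⟩
  have hdom : IsDominant r (insert y τ) := fun z => by
    by_cases hz : z ∈ range e
    · obtain ⟨i, rfl⟩ := hz
      exact ⟨i, fun x _ => he_min i x⟩
    · refine ⟨k, fun x hx => ?_⟩
      rcases Finset.mem_insert.1 hx with rfl | hx
      · exact hymax z hz
      · obtain ⟨i, hi, rfl⟩ := Finset.mem_image.1 hx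
        exact (he_top k i z (Finset.ne_of_mem_erase hi).symm hz).le
  refine ⟨hdom.mono (Finset.subset_insert _ _), Finset.card_eq_one.2 ⟨insert y τ, ?_⟩⟩
  ext σ
  simp only [Finset.mem_filter, Finset.mem_univ, true_and, Finset.mem_singleton]
  constructor
  · rintro ⟨⟨hσ, hσd⟩, hτσ⟩
    obtain ⟨w, hw, rfl⟩ := Finset.exists_eq_insert_iff.2 ⟨hτσ, hcard.trans hσ.symm⟩
    have key : ∀ z, z ∉ range e → r k z ≤ r k w := fun z hz => by
      obtain ⟨i, hi⟩ := hσd z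
      by_cases hik : i = k
      · subst hik
        exact hi w (Finset.mem_insert_self _ _)
      · have := hi (e i) (Finset.mem_insert_of_mem (hmem i hik))
        exact absurd ⟨i, hr i (le_antisymm (he_min i z) this)⟩ hz
    have hwe : w ∉ range e := by
      rintro ⟨i, rfl⟩
      by_cases hik : i = k
      · subst hik
        exact hv ⟨i, hr i (le_antisymm (he_min i v) (key v hv))⟩
      · exact hw (hmem i hik)
    rw [hr k (le_antisymm (hymax w hwe) (key y hy))]
  · rintro rfl
    exact ⟨⟨by rw [Finset.card_insert_of_notMem hyτ, hcard], hdom⟩, Finset.subset_insert _ _⟩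

open Classical in
/-- A set with as many elements as there are colours, but not seeing all of them, has an even
number of subsets with one element less which see all colours but `k`. -/
theorem even_card_facets_of_not_surjective (c : V → I) (k : I) {r : I → V → α} {σ : Finset V}
    (hσ : σ.card = Fintype.card I) (hd : IsDominant r σ) (hc : σ.image c ≠ Finset.univ) :
    Even (Finset.univ.filter fun τ : Finset V =>
      (τ.card + 1 = Fintype.card I ∧ IsDominant r τ ∧ τ.image c = Finset.univ.erase k) ∧
        τ ⊆ σ).card := by
  rcases Finset.eq_empty_or_nonempty (Finset.univ.filter fun τ : Finset V =>
      (τ.card + 1 = Fintype.card I ∧ IsDominant r τ ∧ τ.image c = Finset.univ.erase k) ∧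
        τ ⊆ σ) with h | ⟨τ, hτ⟩
  · simp [h]
  simp only [Finset.mem_filter, Finset.mem_univ, true_and] at hτ
  obtain ⟨⟨hτc, hτd, hτi⟩, hτσ⟩ := hτ
  have hinj : ∀ τ : Finset V, τ.card + 1 = Fintype.card I → τ.image c = Finset.univ.erase k →
      Set.InjOn c τ := fun τ h1 h2 => by
    rw [← Finset.card_image_iff, h2, Finset.card_erase_of_mem (Finset.mem_univ k),
      Finset.card_univ]
    omega
  obtain ⟨x, hx, rfl⟩ := Finset.exists_eq_insert_iff.2 ⟨hτσ, hτc.trans hσ.symm⟩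
  have hxk : c x ≠ k := fun h => hc (by
    rw [Finset.image_insert, hτi, h, Finset.insert_erase (Finset.mem_univ k)])
  obtain ⟨x', hx', hxx'⟩ := Finset.mem_image.1
    (hτi ▸ Finset.mem_erase.2 ⟨hxk, Finset.mem_univ _⟩ : c x ∈ τ.image c)
  have hne : x ≠ x' := fun h => hx (h ▸ hx')
  have h2 : (insert x (τ.erase x')).card = τ.card := by
    rw [Finset.card_insert_of_notMem (fun h => hx (Finset.mem_of_mem_erase h)),
      Finset.card_erase_add_one hx']
  refine ⟨1, Finset.card_eq_two.2 ⟨τ, insert x (τ.erase x'), fun h => hx ?_, ?_⟩⟩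
  · rw [h]; exact Finset.mem_insert_self _ _
  ext ρ
  simp only [Finset.mem_filter, Finset.mem_univ, true_and, Finset.mem_insert,
    Finset.mem_singleton]
  constructor
  · rintro ⟨⟨hρc, -, hρi⟩, hρσ⟩
    have hρ := hinj ρ hρc hρi
    by_cases hxρ : x ∈ ρ
    · right
      refine Finset.eq_of_subset_of_card_le (fun z hz => ?_) (by omega)
      rcases Finset.mem_insert.1 (hρσ hz) with rfl | hz'
      · exact Finset.mem_insert_self _ _
      · refine Finset.mem_insert_of_mem (Finset.mem_erase.2 ⟨?_, hz'⟩)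
        rintro rfl
        exact hne (hρ hxρ hz hxx'.symm)
    · left
      refine Finset.eq_of_subset_of_card_le (fun z hz => ?_) (by omega)
      rcases Finset.mem_insert.1 (hρσ hz) with rfl | hz'
      · exact absurd hz hxρ
      · exact hz'
  · rintro (rfl | rfl)
    · exact ⟨⟨hτc, hτd, hτi⟩, hτσ⟩
    · have hsub : insert x (τ.erase x') ⊆ insert x τ :=
        Finset.insert_subset_insert _ (Finset.erase_subset _ _)
      refine ⟨⟨by omega, hd.mono hsub, ?_⟩, hsub⟩
      rw [← hτi, Finset.image_insert, ← hxx', ← Finset.image_insert, Finset.insert_erase hx']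

open Classical in
/-- **Scarf's lemma**: there is a dominant set on which every colour appears. -/
theorem exists_isDominant_colorful [Nonempty I] {r : I → V → α}
    (hr : ∀ i, Function.Injective (r i))
    {e : I → V} (he_min : ∀ i v, r i (e i) ≤ r i v)
    (he_top : ∀ i j v, i ≠ j → v ∉ range e → r i v < r i (e j))
    (hV : ∃ v, v ∉ range e) {c : V → I} (hc : ∀ i, c (e i) = i) :
    ∃ σ : Finset V, IsDominant r σ ∧ ∀ i, ∃ x ∈ σ, c x = i := by
  obtain ⟨k⟩ := ‹Nonempty I›
  have he : Function.Injective e := Function.LeftInverse.injective hc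
  by_contra! hcon
  let R : Finset (Finset V) :=
    Finset.univ.filter fun σ => σ.card = Fintype.card I ∧ IsDominant r σ
  let D : Finset (Finset V) := Finset.univ.filter fun τ =>
    τ.card + 1 = Fintype.card I ∧ IsDominant r τ ∧ τ.image c = Finset.univ.erase k
  have hsum := Finset.sum_card_bipartiteAbove_eq_sum_card_bipartiteBelow
    (s := D) (t := R) (fun τ σ => τ ⊆ σ)
  have hright : Even (∑ σ ∈ R, (D.bipartiteBelow (fun τ σ => τ ⊆ σ) σ).card) := by
    refine Finset.even_sum _ fun σ hσ => ?_
    simp only [R, Finset.mem_filter, Finset.mem_univ, true_and] at hσ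
    simp only [D, Finset.bipartiteBelow, Finset.filter_filter]
    refine even_card_facets_of_not_surjective c k hσ.1 hσ.2 fun h => ?_
    obtain ⟨i, hi⟩ := hcon σ hσ.2
    obtain ⟨x, hx, hxi⟩ := Finset.mem_image.1 (h ▸ Finset.mem_univ i : i ∈ σ.image c)
    exact hi x hx hxi
  obtain ⟨hbd, hb1⟩ := card_extensions_boundary_eq_one hr he he_min he_top hV k
  set τ₀ := (Finset.univ.erase k).image e with hτ₀
  have hτ₀card : τ₀.card + 1 = Fintype.card I := by
    rw [hτ₀, Finset.card_image_of_injective _ he, Finset.card_erase_add_one (Finset.mem_univ k),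
      Finset.card_univ]
  have hmem : τ₀ ∈ D := by
    simp only [D, Finset.mem_filter, Finset.mem_univ, true_and]
    refine ⟨hτ₀card, hbd, ?_⟩
    rw [hτ₀, Finset.image_image, show c ∘ e = id from funext hc, Finset.image_id]
  have hleft : Even (∑ τ ∈ D.erase τ₀, (R.bipartiteAbove (fun τ σ => τ ⊆ σ) τ).card) := by
    refine Finset.even_sum _ fun τ hτ => ?_
    simp only [D, Finset.mem_erase, Finset.mem_filter, Finset.mem_univ, true_and] at hτ
    obtain ⟨hne, hτc, hτd, hτi⟩ := hτ
    simp only [R, Finset.bipartiteAbove, Finset.filter_filter]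
    have : ∃ v ∈ τ, v ∉ range e := by
      by_contra! hall
      refine hne (Finset.eq_of_subset_of_card_le (fun x hx => ?_) (by omega))
      obtain ⟨i, rfl⟩ := hall x hx
      have := hτi ▸ Finset.mem_image_of_mem c hx
      rw [hc] at this
      exact Finset.mem_image_of_mem e this
    obtain ⟨v, hv, hve⟩ := this
    rw [hτd.card_extensions_eq_two hr he_top hτc hv hve]
    exact even_two
  rw [← hsum, ← Finset.add_sum_erase _ _ hmem] at hright
  have h1 : (R.bipartiteAbove (fun τ σ => τ ⊆ σ) τ₀).card = 1 := by
    simp only [R, Finset.bipartiteAbove, Finset.filter_filter]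
    exact hb1
  rw [h1] at hright
  exact absurd ((Nat.even_add.1 hright).2 hleft) (by decide)

end Scarf

section Brouwer

variable {I : Type*} [Fintype I] [Nonempty I]

open Classical in
/-- A labelling of the points of the discrete simplex of size `N` admits, for every label `i`, a
point `x i` which is labelled `i` or has a small `i`-th coordinate, in such a way that these points
are close to each other. -/
theorem exists_close_labelled_points (N : ℕ) (c : (I → ℕ) → I) :
    ∃ x : I → I → ℕ, (∀ i, ∑ j, x i j = N) ∧ (∀ i i' j, x i j ≤ x i' j + Fintype.card I) ∧
      ∀ i, x i i ≤ Fintype.card I ∨ c (x i) = i := by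
  let T := {x : I → ℕ // x ∈ Finset.piAntidiag (Finset.univ : Finset I) N}
  have hT : ∀ x : T, ∑ j, x.1 j = N := fun x => (Finset.mem_piAntidiag.1 x.2).1
  have hTmk : ∀ x : I → ℕ, ∑ j, x j = N → ∃ t : T, t.1 = x := fun x hx =>
    ⟨⟨x, Finset.mem_piAntidiag.2 ⟨hx, fun _ _ => Finset.mem_univ _⟩⟩, rfl⟩
  let a : I → T ⊕ I → ℕ := fun i =>
    Sum.elim (fun x => x.1 i + 1) (fun j => if j = i then 0 else N + 2)
  let r : I → T ⊕ I → ℕ ×ₗ Fin (Fintype.card (T ⊕ I)) := fun i v =>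
    toLex (a i v, Fintype.equivFin _ v)
  have hra : ∀ i v w, a i v < a i w → r i v < r i w := fun i v w h =>
    Prod.Lex.toLex_lt_toLex.2 (Or.inl h)
  have har : ∀ i v w, r i v ≤ r i w → a i v ≤ a i w := fun i v w h => by
    rcases Prod.Lex.toLex_le_toLex.1 h with h | h
    exacts [h.le, h.1.le]
  have hr : ∀ i, Function.Injective (r i) := fun i v w h => by
    have := congrArg (fun p => (ofLex p).2) h
    exact (Fintype.equivFin _).injective this
  have hle : ∀ (t : T) i, t.1 i ≤ N := fun t i =>
    (Finset.single_le_sum (f := t.1) (fun _ _ => Nat.zero_le _) (Finset.mem_univ i)).trans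
      (hT t).le
  obtain ⟨i₀⟩ := ‹Nonempty I›
  obtain ⟨t₀, -⟩ := hTmk (Pi.single i₀ N) (by simp)
  obtain ⟨σ, hσ, hcol⟩ := exists_isDominant_colorful (I := I) (V := T ⊕ I) hr (e := Sum.inr)
    (fun i v => by
      by_cases h : v = Sum.inr i
      · rw [h]
      · refine (hra i _ _ ?_).le
        rcases v with v | j
        · simp [a]
        · have : j ≠ i := fun hj => h (hj ▸ rfl)
          simp [a, this])
    (fun i j v hij hv => by
      rcases v with v | l
      · refine hra i _ _ ?_
        have := hle v i
        simp only [a, Sum.elim_inl, Sum.elim_inr, if_neg hij.symm]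
        omega
      · exact absurd ⟨l, rfl⟩ hv)
    ⟨Sum.inl t₀, by simp⟩ (c := Sum.elim (fun t => c t.1) id) (fun i => rfl)
  have hdom : ∀ t : T, ∃ i, Sum.inr i ∉ σ ∧ ∀ s : T, Sum.inl s ∈ σ → t.1 i ≤ s.1 i := fun t => by
    obtain ⟨i, hi⟩ := hσ (Sum.inl t)
    refine ⟨i, fun h => ?_, fun s hs => ?_⟩
    · have := har _ _ _ (hi _ h)
      simp [a] at this
    · have := har _ _ _ (hi _ hs)
      simpa [a] using this
  have hcol' : ∀ i, Sum.inr i ∉ σ → ∃ s : T, Sum.inl s ∈ σ ∧ c s.1 = i := fun i hi => by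
    obtain ⟨x | j, hx, hxi⟩ := hcol i
    · exact ⟨x, hx, hxi⟩
    · exact absurd ((show j = i from hxi) ▸ hx) hi
  obtain ⟨s₀, hs₀⟩ : ∃ s : T, Sum.inl s ∈ σ := by
    obtain ⟨i, hi, -⟩ := hdom t₀
    obtain ⟨s, hs, -⟩ := hcol' i hi
    exact ⟨s, hs⟩
  have hm : ∀ i, ∃ n : ℕ, (∀ s : T, Sum.inl s ∈ σ → n ≤ s.1 i) ∧
      (Sum.inr i ∈ σ → n = 0) ∧ (Sum.inr i ∉ σ → ∃ s : T, Sum.inl s ∈ σ ∧ s.1 i = n) :=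
    fun i => by
    by_cases hi : Sum.inr i ∈ σ
    · exact ⟨0, fun _ _ => Nat.zero_le _, fun _ => rfl, fun h => absurd hi h⟩
    · obtain ⟨s, hs, hmin⟩ := Finset.exists_min_image
        (Finset.univ.filter fun s : T => Sum.inl s ∈ σ) (fun s => s.1 i) ⟨s₀, by simpa using hs₀⟩
      simp only [Finset.mem_filter, Finset.mem_univ, true_and] at hs hmin
      exact ⟨s.1 i, hmin, fun h => absurd h hi, fun _ => ⟨s, hs, rfl⟩⟩
  choose m hmle hm0 hmeq using hm
  have hsum : N < ∑ i, m i + Fintype.card I := by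
    by_contra! hcon
    have h1 : ∑ i, (m i + 1) ≤ N := by
      simpa [Finset.sum_add_distrib] using hcon
    obtain ⟨t, ht⟩ := hTmk (fun i => (m i + 1) + if i = i₀ then N - ∑ i, (m i + 1) else 0) (by
      rw [Finset.sum_add_distrib, Finset.sum_ite_eq']
      simp only [Finset.mem_univ, if_true]
      omega)
    obtain ⟨i, hi, hlt⟩ := hdom t
    obtain ⟨s, hs, hsm⟩ := hmeq i hi
    have := hlt s hs
    rw [ht] at this
    simp only at this
    omega
  have hub : ∀ s : T, Sum.inl s ∈ σ → ∀ i, s.1 i ≤ m i + Fintype.card I := fun s hs i => by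
    have h1 := hT s
    have h2 : ∑ j ∈ Finset.univ.erase i, m j ≤ ∑ j ∈ Finset.univ.erase i, s.1 j :=
      Finset.sum_le_sum fun j _ => hmle j s hs
    rw [← Finset.add_sum_erase _ _ (Finset.mem_univ i)] at h1 hsum
    omega
  have hx : ∀ i, ∃ s : T, Sum.inl s ∈ σ ∧ (s.1 i ≤ Fintype.card I ∨ c s.1 = i) := fun i => by
    by_cases hi : Sum.inr i ∈ σ
    · refine ⟨s₀, hs₀, Or.inl ?_⟩
      simpa [hm0 i hi] using hub s₀ hs₀ i
    · obtain ⟨s, hs, hsc⟩ := hcol' i hi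
      exact ⟨s, hs, Or.inr hsc⟩
  choose x hxσ hx using hx
  exact ⟨fun i => (x i).1, fun i => hT _,
    fun i i' j => (hub _ (hxσ i) j).trans (Nat.add_le_add_right (hmle j _ (hxσ i')) _), hx⟩

/-- **Brouwer's fixed point theorem** for the standard simplex. -/
theorem exists_fixedPoint_stdSimplex {f : (I → ℝ) → I → ℝ}
    (hf : ContinuousOn f (stdSimplex ℝ I)) (hmaps : MapsTo f (stdSimplex ℝ I) (stdSimplex ℝ I)) :
    ∃ x ∈ stdSimplex ℝ I, f x = x := by
  let P : ℕ → (I → ℕ) → I → ℝ := fun k x j => (x j : ℝ) / ((k : ℝ) + 1)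
  have hP : ∀ k x, ∑ j, x j = k + 1 → P k x ∈ stdSimplex ℝ I := fun k x hx => by
    refine ⟨fun j => by positivity, ?_⟩
    simp only [P]
    rw [← Finset.sum_div, div_eq_one_iff_eq (by positivity)]
    exact_mod_cast hx
  have hlabel : ∀ p ∈ stdSimplex ℝ I, ∃ i, p i ≤ f p i := fun p hp => by
    by_contra! hcon
    have := Finset.sum_lt_sum_of_nonempty Finset.univ_nonempty fun i _ => hcon i
    rw [hp.2, (hmaps hp).2] at this
    exact lt_irrefl _ this
  have hc : ∀ k, ∃ c : (I → ℕ) → I, ∀ x, ∑ j, x j = k + 1 →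
      P k x (c x) ≤ f (P k x) (c x) := fun k => by
    have : ∀ x : I → ℕ, ∃ i, ∑ j, x j = k + 1 → P k x i ≤ f (P k x) i := fun x => by
      by_cases hx : ∑ j, x j = k + 1
      · obtain ⟨i, hi⟩ := hlabel _ (hP k x hx)
        exact ⟨i, fun _ => hi⟩
      · exact ⟨Classical.arbitrary I, fun h => absurd h hx⟩
    choose c hc using this
    exact ⟨c, hc⟩
  choose c hc using hc
  choose x hxsum hxclose hxlabel using fun k => exists_close_labelled_points (k + 1) (c k)
  let ε : ℕ → ℝ := fun k => (Fintype.card I : ℝ) / ((k : ℝ) + 1)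
  have hε : Tendsto ε atTop (𝓝 0) := by
    have := (tendsto_one_div_add_atTop_nhds_zero_nat (𝕜 := ℝ)).const_mul (Fintype.card I : ℝ)
    simpa [ε, div_eq_mul_inv] using this
  have hclose : ∀ k i i' j, P k (x k i) j ≤ P k (x k i') j + ε k := fun k i i' j => by
    simp only [P, ε]
    rw [← add_div]
    gcongr
    exact_mod_cast hxclose k i i' j
  have hfix : ∀ k i, P k (x k i) i ≤ f (P k (x k i)) i + ε k := fun k i => by
    have hε0 : 0 ≤ ε k := by positivity
    rcases hxlabel k i with h | h
    · have h1 : P k (x k i) i ≤ ε k := by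
        simp only [P, ε]
        gcongr
      have := (hmaps (hP k _ (hxsum k i))).1 i
      linarith
    · have := hc k _ (hxsum k i)
      rw [h] at this
      linarith
  let i₀ := Classical.arbitrary I
  obtain ⟨q, hq, φ, hφ, hlim⟩ := (isCompact_stdSimplex ℝ I).tendsto_subseq
    fun k => hP k _ (hxsum k i₀)
  have hεφ : Tendsto (fun k => ε (φ k)) atTop (𝓝 0) := hε.comp hφ.tendsto_atTop
  have hlim' : ∀ i, Tendsto (fun k => P (φ k) (x (φ k) i)) atTop (𝓝 q) := fun i => by
    rw [tendsto_pi_nhds] at hlim ⊢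
    intro j
    refine tendsto_of_tendsto_of_tendsto_of_le_of_le
      (g := fun k => P (φ k) (x (φ k) i₀) j - ε (φ k))
      (h := fun k => P (φ k) (x (φ k) i₀) j + ε (φ k)) ?_ ?_ (fun k => ?_) (fun k => ?_)
    · simpa using (hlim j).sub hεφ
    · simpa using (hlim j).add hεφ
    · have := hclose (φ k) i₀ i j
      simp only
      linarith
    · exact hclose (φ k) i i₀ j
  have hle : ∀ i, q i ≤ f q i := fun i => by
    have h1 : Tendsto (fun k => f (P (φ k) (x (φ k) i))) atTop (𝓝 (f q)) :=
      (hf q hq).tendsto.comp (tendsto_nhdsWithin_iff.2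
        ⟨hlim' i, Eventually.of_forall fun k => hP _ _ (hxsum _ i)⟩)
    have h2 := ((tendsto_pi_nhds.1 h1) i).add hεφ
    rw [add_zero] at h2
    exact le_of_tendsto_of_tendsto' ((tendsto_pi_nhds.1 (hlim' i)) i) h2 fun k => hfix _ i
  refine ⟨q, hq, funext fun i => ?_⟩
  have := (Finset.sum_eq_sum_iff_of_le (s := Finset.univ) fun i _ => hle i).1
    (by rw [hq.2, (hmaps hq).2])
  exact (this i (Finset.mem_univ i)).symm

end Brouwer

section Kakutani

/-- A multivalued map with closed graph and values in a compact set is upper semicontinuous. -/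
theorem HasClosedGraphMV.exists_values_subset_thickening {E : Type*} [PseudoMetricSpace E]
    {C : Set E} (hC : IsCompact C)
    {Q : E → Set E} (hQC : ∀ x ∈ C, Q x ⊆ C) (hQ : HasClosedGraphMV C Q) {a : E} (ha : a ∈ C)
    {δ : ℝ} (hδ : 0 < δ) :
    ∃ ε > 0, ∀ z ∈ C, dist z a < ε → Q z ⊆ Metric.thickening δ (Q a) := by
  by_contra! hcon
  choose z hzC hza hz using fun k : ℕ => hcon (1 / ((k : ℝ) + 1)) (by positivity)
  choose y hyQ hy using fun k => not_subset.1 (hz k)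
  obtain ⟨b, -, φ, hφ, hlim⟩ := hC.tendsto_subseq fun k => hQC _ (hzC k) (hyQ k)
  have hzlim : Tendsto z atTop (𝓝 a) := tendsto_iff_dist_tendsto_zero.2
    (squeeze_zero (fun _ => dist_nonneg) (fun k => (hza k).le)
      tendsto_one_div_add_atTop_nhds_zero_nat)
  have hb : b ∈ Q a := hQ (z ∘ φ) (y ∘ φ) a b (fun k => hzC _) ha
    (hzlim.comp hφ.tendsto_atTop) (fun k => hyQ _) hlim
  obtain ⟨k, hk⟩ := (hlim.eventually (Metric.isOpen_thickening.mem_nhds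
    (Metric.self_subset_thickening hδ _ hb))).exists
  exact hy _ hk

variable {E : Type*} [NormedAddCommGroup E] [NormedSpace ℝ E]

/-- A multivalued self-map of a compact convex set with nonempty values has approximate fixed
points. -/
theorem exists_mem_convexHull_values {C : Set E} (hC : IsCompact C) (hCv : Convex ℝ C)
    (hCne : C.Nonempty) {Q : E → Set E} (hQne : ∀ x ∈ C, (Q x).Nonempty)
    (hQC : ∀ x ∈ C, Q x ⊆ C) {ε : ℝ} (hε : 0 < ε) :
    ∃ x ∈ C, x ∈ convexHull ℝ (⋃ z ∈ C ∩ Metric.ball x ε, Q z) := by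
  obtain ⟨t, htC, htf, hcover⟩ := hC.finite_cover_balls hε
  have hcover' : ∀ x ∈ C, ∃ i : t, dist x i < ε := fun x hx => by
    obtain ⟨i, hi, hxi⟩ := mem_iUnion₂.1 (hcover hx)
    exact ⟨⟨i, hi⟩, hxi⟩
  have : Fintype t := htf.fintype
  have : Nonempty t := hCne.elim fun x hx => ⟨(hcover' x hx).choose⟩
  choose y hy using fun i : t => hQne i (htC i.2)
  let g : (t → ℝ) → E := fun l => ∑ i, l i • y i
  let w : E → t → ℝ := fun x i => max 0 (ε - dist x i)
  let W : E → ℝ := fun x => ∑ i, w x i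
  have hw0 : ∀ x i, 0 ≤ w x i := fun x i => le_max_left _ _
  have hWpos : ∀ x ∈ C, 0 < W x := fun x hx => by
    obtain ⟨i, hi⟩ := hcover' x hx
    exact Finset.sum_pos' (fun i _ => hw0 x i)
      ⟨i, Finset.mem_univ i, lt_max_of_lt_right (sub_pos.2 hi)⟩
  have hgC : ∀ l ∈ stdSimplex ℝ t, g l ∈ C := fun l hl =>
    hCv.sum_mem (fun i _ => hl.1 i) hl.2 fun i _ => hQC i (htC i.2) (hy i)
  have hg : Continuous g := by fun_prop
  have hw : ∀ i, Continuous fun x => w x i := fun i => by fun_prop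
  have hW : Continuous W := continuous_finsetSum _ fun i _ => hw i
  obtain ⟨l, hl, hfix⟩ := exists_fixedPoint_stdSimplex (f := fun l i => w (g l) i / W (g l))
    (continuousOn_pi.2 fun i => ((hw i).comp hg).continuousOn.div (hW.comp hg).continuousOn
      fun l hl => (hWpos _ (hgC l hl)).ne')
    (fun l hl => ⟨fun i => div_nonneg (hw0 _ _) (hWpos _ (hgC l hl)).le, by
      rw [← Finset.sum_div]
      exact div_self (hWpos _ (hgC l hl)).ne'⟩)
  refine ⟨g l, hgC l hl, ?_⟩
  have hsum : g l = ∑ i ∈ Finset.univ.filter fun i => l i ≠ 0, l i • y i :=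
    (Finset.sum_filter_of_ne (p := fun i => l i ≠ 0) fun i _ h h0 => h (by
      rw [h0, zero_smul])).symm
  have hmem : ∑ i ∈ Finset.univ.filter fun i => l i ≠ 0, l i • y i ∈
      convexHull ℝ (⋃ z ∈ C ∩ Metric.ball (g l) ε, Q z) := by
    refine (convex_convexHull ℝ _).sum_mem (fun i _ => hl.1 i)
      ((Finset.sum_filter_of_ne fun i _ h => h).trans hl.2) fun i hi => ?_
    refine subset_convexHull ℝ _ (mem_iUnion₂.2 ⟨i, ⟨htC i.2, ?_⟩, hy i⟩)
    have hli := (Finset.mem_filter.1 hi).2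
    rw [Metric.mem_ball']
    by_contra! hdist
    refine hli ?_
    rw [← congrFun hfix i]
    simp only [w]
    rw [max_eq_left (sub_nonpos.2 hdist), zero_div]
  rwa [← hsum] at hmem

/-- **Kakutani's fixed point theorem** in normed spaces. -/
theorem HasClosedGraphMV.exists_fixedPoint_of_isCompact {C : Set E} (hC : IsCompact C)
    (hCv : Convex ℝ C) (hCne : C.Nonempty) {Q : E → Set E}
    (hQval : ∀ x ∈ C, (Q x).Nonempty ∧ IsClosed (Q x) ∧ Convex ℝ (Q x) ∧ Q x ⊆ C)
    (hQ : HasClosedGraphMV C Q) : ∃ x ∈ C, x ∈ Q x := by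
  have hQC : ∀ x ∈ C, Q x ⊆ C := fun x hx => (hQval x hx).2.2.2
  choose x hxC hx using fun k : ℕ => exists_mem_convexHull_values hC hCv hCne
    (fun x hx => (hQval x hx).1) hQC (ε := 1 / ((k : ℝ) + 1)) (by positivity)
  obtain ⟨a, ha, φ, hφ, hlim⟩ := hC.tendsto_subseq hxC
  refine ⟨a, ha, ?_⟩
  obtain ⟨-, hcl, hcv, -⟩ := hQval a ha
  rw [← hcl.closure_eq, Metric.closure_eq_iInter_cthickening]
  refine mem_iInter₂.2 fun δ hδ => ?_
  obtain ⟨ε, hε, hsub⟩ := hQ.exists_values_subset_thickening hC hQC ha hδ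
  refine Metric.closure_thickening_subset_cthickening δ _ (mem_closure_of_tendsto hlim ?_)
  have h1 := hlim.eventually (Metric.ball_mem_nhds a (half_pos hε))
  have h2 := (tendsto_one_div_add_atTop_nhds_zero_nat (𝕜 := ℝ)).comp hφ.tendsto_atTop
  filter_upwards [h1, h2.eventually (gt_mem_nhds (half_pos hε))] with k hk1 hk2
  refine convexHull_min (iUnion₂_subset fun z hz => hsub z hz.1 ?_) (hcv.thickening δ) (hx (φ k))
  have h3 : dist z (x (φ k)) < 1 / (((φ k : ℕ) : ℝ) + 1) := hz.2
  have h4 : dist (x (φ k)) a < ε / 2 := hk1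
  have h5 : 1 / (((φ k : ℕ) : ℝ) + 1) < ε / 2 := hk2
  linarith [dist_triangle z (x (φ k)) a]

/-- The **Bohnenblust–Karlin fixed point theorem** in Banach spaces. -/
theorem HasClosedGraphMV.exists_fixedPoint [CompleteSpace E] {S : Set E} (hS : S.Nonempty)
    (hScl : IsClosed S) (hScv : Convex ℝ S) {Q : E → Set E}
    (hQval : ∀ x ∈ S, (Q x).Nonempty ∧ IsClosed (Q x) ∧ Convex ℝ (Q x) ∧ Q x ⊆ S)
    (hQ : HasClosedGraphMV S Q) (hQS : IsCompact (closure (⋃ x ∈ S, Q x))) :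
    ∃ x ∈ S, x ∈ Q x := by
  let C := closure (convexHull ℝ (closure (⋃ x ∈ S, Q x)))
  have hCS : C ⊆ S := closure_minimal (convexHull_min (closure_minimal
    (iUnion₂_subset fun x hx => (hQval x hx).2.2.2) hScl) hScv) hScl
  have hQC : ∀ x ∈ S, Q x ⊆ C := fun x hx => (subset_biUnion_of_mem (u := Q) hx).trans
    (subset_closure.trans ((subset_convexHull ℝ _).trans subset_closure))
  have hC : IsCompact C := isCompact_iff_totallyBounded_isComplete.2
    ⟨(totallyBounded_convexHull.2 hQS.totallyBounded).closure, isClosed_closure.isComplete⟩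
  obtain ⟨s, hs⟩ := hS
  obtain ⟨x, hx, hxQ⟩ := HasClosedGraphMV.exists_fixedPoint_of_isCompact hC
    (convex_convexHull ℝ _).closure ((hQval s hs).1.mono (hQC s hs))
    (fun x hx => ⟨(hQval x (hCS hx)).1, (hQval x (hCS hx)).2.1, (hQval x (hCS hx)).2.2.1,
      hQC x (hCS hx)⟩)
    (fun x y a b hx ha => hQ x y a b (fun m => hCS (hx m)) (hCS ha))
  exact ⟨x, hCS hx, hxQ⟩

end Kakutani

/-- in a generalized Banach space `E`, a multivalued map `Q` with closed
graph on a nonempty closed convex `S ⊆ E`, with nonempty closed convex values contained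
in `S` and `Q(S)` relatively compact, has a fixed point in `S`. -/
theorem stmt_5
    {E : Type*} [AddCommGroup E] [Module ℝ E] [MetricSpace E] [CompleteSpace E]
    {n : ℕ} (hn : 1 ≤ n) (N : Fin n → E → ℝ)
    (hN_nonneg : ∀ i x, 0 ≤ N i x)
    (hN_triangle : ∀ i (x y : E), N i (x + y) ≤ N i x + N i y)
    (hN_smul : ∀ i (a : ℝ) (x : E), N i (a • x) = |a| * N i x)
    (hN_zero : ∀ i (x : E), N i x = 0 → x = 0)
    (hdist : ∀ x y : E, dist x y = ⨆ i, N i (x - y))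
    (S : Set E) (hS : S.Nonempty) (hScl : IsClosed S) (hScv : Convex ℝ S)
    (Q : E → Set E)
    (hQval : ∀ x ∈ S, (Q x).Nonempty ∧ IsClosed (Q x) ∧ Convex ℝ (Q x) ∧ Q x ⊆ S)
    (hQgraph : HasClosedGraphMV S Q)
    (hQS : IsCompact (closure (⋃ x ∈ S, Q x))) :
    ∃ x ∈ S, x ∈ Q x := by
  have : Nonempty (Fin n) := ⟨⟨0, hn⟩⟩
  have hbdd : ∀ x, BddAbove (range fun i => N i x) := fun x => (finite_range _).bddAbove
  let : NormedAddCommGroup E :=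
    { ‹AddCommGroup E›, ‹MetricSpace E› with
      norm := fun x => ⨆ i, N i x
      dist_eq := fun x y => by
        rw [dist_comm, hdist, sub_eq_neg_add] }
  let : NormedSpace ℝ E :=
    { ‹Module ℝ E› with
      norm_smul_le := fun c x => by
        refine ciSup_le fun i => ?_
        rw [hN_smul]
        exact mul_le_mul_of_nonneg_left (le_ciSup (hbdd x) i) (abs_nonneg c) }
  exact hQgraph.exists_fixedPoint hS hScl hScv hQval hQS
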